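/- Let L : ℕ → ℂ → ℂ satisfy L 0 z = z for all z ∈ ℂ, and let D : ℕ → ℂ → ℂ satisfy D 1 z = z for all z ∈ ℂ and, for every m ≥ 1 and every z ∈ ℂ, D (m+1) z = (z / 2^(m+1)) · ∑_{i=0}^{m} (m choose i) · ( D (i+1) z + (L i z) · (D (m-i+1) z) ). Then for every m ≥ 1 and every z ∈ ℂ with z·(z+1) ≠ 2^(m+1), one has D (m+1) z = (z / (2^(m+1) − z·(z+1))) · ( z·(1 + L m z) + ∑_{i=1}^{m-1} (m choose i) · ( D (i+1) z + (L i z) · (D (m-i+1) z) ) ). -/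

import Mathlib

open Finset Complex

/-- Lemma 2 (Capetanakis tree algorithm, binary fair splitting): rearrangement of the
splitting relation for the PGF of the decoding slot of a reference user, isolating
`D (m+1) z`. -/
theorem ctm_decoding_pgf_recursion
    (L D : ℕ → ℂ → ℂ)
    (hL0 : ∀ z : ℂ, L 0 z = z)
    (hD1 : ∀ z : ℂ, D 1 z = z)
    (hrec : ∀ m : ℕ, 1 ≤ m → ∀ z : ℂ,
      D (m + 1) z = (z / 2 ^ (m + 1)) *
        ∑ i ∈ Finset.range (m + 1),
          (m.choose i : ℂ) * (D (i + 1) z + L i z * D (m - i + 1) z)) :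
    ∀ m : ℕ, 1 ≤ m → ∀ z : ℂ, z * (z + 1) ≠ (2 : ℂ) ^ (m + 1) →
      D (m + 1) z = z / ((2 : ℂ) ^ (m + 1) - z * (z + 1)) *
        (z * (1 + L m z) +
          ∑ i ∈ Finset.Icc 1 (m - 1),
            (m.choose i : ℂ) * (D (i + 1) z + L i z * D (m - i + 1) z)) := by
  intro m hm z hz
  have hIcc : Finset.Icc 1 (m - 1) = Finset.Ico 1 m := by
    ext i
    simp only [Finset.mem_Icc, Finset.mem_Ico]
    omega
  have h := hrec m hm z
  rw [Finset.sum_range_succ, Finset.range_eq_Ico, Finset.sum_eq_sum_Ico_succ_bot hm] at h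
  simp only [Nat.choose_zero_right, Nat.choose_self, Nat.cast_one, one_mul, Nat.sub_zero,
    Nat.sub_self, zero_add, hL0, hD1] at h
  rw [hIcc]
  generalize ∑ i ∈ Finset.Ico 1 m,
    (m.choose i : ℂ) * (D (i + 1) z + L i z * D (m - i + 1) z) = S at h ⊢
  have hpow : (2 : ℂ) ^ (m + 1) ≠ 0 := pow_ne_zero _ two_ne_zero
  have hden : (2 : ℂ) ^ (m + 1) - z * (z + 1) ≠ 0 := sub_ne_zero.mpr hz.symm
  generalize (2 : ℂ) ^ (m + 1) = p at h hpow hden ⊢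
  rw [div_mul_eq_mul_div, eq_div_iff hpow] at h
  rw [div_mul_eq_mul_div, eq_div_iff hden]
  linear_combination h
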